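/- arXiv:1405.3211 — 3 statements merged into one kernel-verified Lean document; each statement's English description precedes it below -/
import Mathlib

section
/- Every correlation p achievable by local shared randomness plus one bit of communication from Alice to Bob (with M_A = 3, M_B = 2 measurement settings and binary outcomes) satisfies Bell inequality V: −q_A(0|0) + p(00|00) − p(00|10) − p(00|20) + p(00|01) − p(00|11) + p(00|21) − p(10|10) + p(10|20) − p(10|11) − p(10|21) ≤ 1. -/
/-- The correlation of a deterministic Alice→Bob one-bit strategy `(κ, f, g)`
for 3×2 measurement settings with binary outcomes. -/
def detCorr (κ : Fin 3 → Fin 2) (f : Fin 3 → Fin 2) (g : Fin 2 × Fin 2 → Fin 2)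
    (a b : Fin 2) (i : Fin 3) (j : Fin 2) : ℝ :=
  if a = f i ∧ b = g (j, κ i) then 1 else 0

/-- A correlation is achievable by local shared randomness plus one bit of
communication from Alice to Bob if it is a convex combination of correlations
of deterministic Alice→Bob one-bit strategies. -/
def AchievableAtoB (p : Fin 2 → Fin 2 → Fin 3 → Fin 2 → ℝ) : Prop :=
  ∃ (n : ℕ) (w : Fin n → ℝ) (κ : Fin n → Fin 3 → Fin 2) (f : Fin n → Fin 3 → Fin 2)
    (g : Fin n → Fin 2 × Fin 2 → Fin 2),
    (∀ k, 0 ≤ w k) ∧ (∑ k, w k = 1) ∧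
    ∀ a b i j, p a b i j = ∑ k, w k * detCorr (κ k) (f k) (g k) a b i j

/-- Alice's marginal probability of outcome 0 on input `i`. -/
def qA0 (p : Fin 2 → Fin 2 → Fin 3 → Fin 2 → ℝ) (i : Fin 3) : ℝ :=
  p 0 0 i 0 + p 0 1 i 0

/-- Integer-valued version of `detCorr`. -/
def detInt (κ : Fin 3 → Fin 2) (f : Fin 3 → Fin 2) (g : Fin 2 × Fin 2 → Fin 2)
    (a b : Fin 2) (i : Fin 3) (j : Fin 2) : ℤ :=
  if a = f i ∧ b = g (j, κ i) then 1 else 0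

theorem detCorr_eq_cast (κ : Fin 3 → Fin 2) (f : Fin 3 → Fin 2) (g : Fin 2 × Fin 2 → Fin 2)
    (a b : Fin 2) (i : Fin 3) (j : Fin 2) :
    detCorr κ f g a b i j = (detInt κ f g a b i j : ℝ) := by
  unfold detCorr detInt
  split_ifs <;> simp

theorem detInt_bound (κ : Fin 3 → Fin 2) (f : Fin 3 → Fin 2) (g : Fin 2 × Fin 2 → Fin 2) :
    -(detInt κ f g 0 0 0 0 + detInt κ f g 0 1 0 0) + detInt κ f g 0 0 0 0
      - detInt κ f g 0 0 1 0 - detInt κ f g 0 0 2 0 + detInt κ f g 0 0 0 1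
      - detInt κ f g 0 0 1 1 + detInt κ f g 0 0 2 1 - detInt κ f g 1 0 1 0
      + detInt κ f g 1 0 2 0 - detInt κ f g 1 0 1 1 - detInt κ f g 1 0 2 1 ≤ 1 := by
  unfold detInt
  generalize κ 0 = k0, κ 1 = k1, κ 2 = k2, f 0 = f0, f 1 = f1, f 2 = f2
  have h : ∀ x : Fin 2 × Fin 2, g x = (![![g (0,0), g (0,1)], ![g (1,0), g (1,1)]] x.1 x.2) := by
    rintro ⟨a, b⟩
    fin_cases a <;> fin_cases b <;> rfl
  simp only [h (0, k0), h (0, k1), h (0, k2), h (1, k0), h (1, k1), h (1, k2)]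
  generalize g (0,0) = a, g (0,1) = b, g (1,0) = c, g (1,1) = d
  clear h
  revert k0 k1 k2 f0 f1 f2 a b c d
  set_option maxRecDepth 100000 in decide +kernel

/-- Bell inequality V for LSR plus one bit of Alice→Bob communication. -/
theorem bell_V (p : Fin 2 → Fin 2 → Fin 3 → Fin 2 → ℝ) (h : AchievableAtoB p) :
    -qA0 p 0 + p 0 0 0 0 - p 0 0 1 0 - p 0 0 2 0 + p 0 0 0 1 - p 0 0 1 1 + p 0 0 2 1 - p 1 0 1 0 + p 1 0 2 0 - p 1 0 1 1 - p 1 0 2 1 ≤ 1 := by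
  obtain ⟨n, w, κ, f, g, hw, hs, hp⟩ := h
  rw [← hs]
  simp only [qA0, hp, ← Finset.sum_add_distrib, ← Finset.sum_sub_distrib,
    ← Finset.sum_neg_distrib]
  refine Finset.sum_le_sum fun k _ => ?_
  have hb := detInt_bound (κ k) (f k) (g k)
  have hb' := (Int.cast_le (R := ℝ)).2 hb
  push_cast at hb'
  simp only [← detCorr_eq_cast] at hb'
  have := mul_le_mul_of_nonneg_left hb' (hw k)
  linarith
end

section
/- Every correlation p achievable by local shared randomness plus one bit of communication from Alice to Bob (with M_A = 3, M_B = 2 measurement settings and binary outcomes) satisfies Bell inequality VI: −3·q_A(0|0) + 2·p(00|00) − 2·p(00|10) + 2·p(00|01) + p(00|11) − p(00|21) − p(10|00) − p(10|10) + p(10|20) − p(10|01) − 2·p(10|21) ≤ 1. -/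
def bellTermI (x y u v : Fin 2) : ℤ := if x = u ∧ y = v then 1 else 0

lemma bell_int : ∀ k0 k1 k2 f0 f1 f2 : Fin 2, ∀ a0 a1 b0 b1 : Fin 2,
    let A : Fin 2 → Fin 2 := fun k => (if k = 0 then a0 else a1);
    let B : Fin 2 → Fin 2 := fun k => (if k = 0 then b0 else b1);
    -3 * (bellTermI 0 0 f0 (A k0) + bellTermI 0 1 f0 (A k0))
      + 2 * bellTermI 0 0 f0 (A k0) - 2 * bellTermI 0 0 f1 (A k1)
      + 2 * bellTermI 0 0 f0 (B k0) + bellTermI 0 0 f1 (B k1) - bellTermI 0 0 f2 (B k2)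
      - bellTermI 1 0 f0 (A k0) - bellTermI 1 0 f1 (A k1) + bellTermI 1 0 f2 (A k2)
      - bellTermI 1 0 f0 (B k0) - 2 * bellTermI 1 0 f2 (B k2) ≤ 1 := by
  decide +kernel

lemma bell_det (κ f : Fin 3 → Fin 2) (g : Fin 2 × Fin 2 → Fin 2) :
    -3 * qA0 (detCorr κ f g) 0 + 2 * detCorr κ f g 0 0 0 0 - 2 * detCorr κ f g 0 0 1 0
      + 2 * detCorr κ f g 0 0 0 1 + detCorr κ f g 0 0 1 1 - detCorr κ f g 0 0 2 1
      - detCorr κ f g 1 0 0 0 - detCorr κ f g 1 0 1 0 + detCorr κ f g 1 0 2 0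
      - detCorr κ f g 1 0 0 1 - 2 * detCorr κ f g 1 0 2 1 ≤ 1 := by
  have key : ∀ a b i j, detCorr κ f g a b i j = ((bellTermI a b (f i) (g (j, κ i)) : ℤ) : ℝ) := by
    intro a b i j
    unfold detCorr bellTermI
    split_ifs <;> simp
  have hg : ∀ j k : Fin 2, (if k = 0 then g (j, 0) else g (j, 1)) = g (j, k) := by
    intro j k
    fin_cases k <;> simp
  have h := bell_int (κ 0) (κ 1) (κ 2) (f 0) (f 1) (f 2) (g (0, 0)) (g (0, 1)) (g (1, 0)) (g (1, 1))
  simp only [hg] at h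
  simp only [qA0, key]
  exact_mod_cast h

/-- Bell inequality VI for LSR plus one bit of Alice→Bob communication. -/
theorem bell_VI (p : Fin 2 → Fin 2 → Fin 3 → Fin 2 → ℝ) (h : AchievableAtoB p) :
    -3 * qA0 p 0 + 2 * p 0 0 0 0 - 2 * p 0 0 1 0 + 2 * p 0 0 0 1 + p 0 0 1 1 - p 0 0 2 1 - p 1 0 0 0 - p 1 0 1 0 + p 1 0 2 0 - p 1 0 0 1 - 2 * p 1 0 2 1 ≤ 1 := by
  obtain ⟨n, w, κ, f, g, hw, hs, hp⟩ := h
  have h1 := Finset.sum_le_sum (s := Finset.univ) fun k _ =>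
    mul_le_mul_of_nonneg_left (bell_det (κ k) (f k) (g k)) (hw k)
  simp only [mul_one, hs] at h1
  refine le_trans (le_of_eq ?_) h1
  simp only [qA0, hp, Finset.mul_sum, ← Finset.sum_add_distrib, ← Finset.sum_sub_distrib]
  refine Finset.sum_congr rfl fun k _ => ?_
  ring
end

section
/- Every correlation p achievable by local shared randomness plus one bit of communication from Alice to Bob (with M_A = 3, M_B = 2 measurement settings and binary outcomes) satisfies Bell inequality VIII: −3·q_A(0|0) + 2·p(00|00) − 2·p(00|10) + p(00|20) + 2·p(00|01) + p(00|11) − 2·p(00|21) − p(10|00) − 2·p(10|10) + p(10|20) − p(10|01) + p(10|11) − 2·p(10|21) ≤ 1. -/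
/-- The inequality for a deterministic strategy. -/
lemma det_bound (κ : Fin 3 → Fin 2) (f : Fin 3 → Fin 2) (g : Fin 2 × Fin 2 → Fin 2) :
    -3 * qA0 (detCorr κ f g) 0 + 2 * detCorr κ f g 0 0 0 0 - 2 * detCorr κ f g 0 0 1 0
      + detCorr κ f g 0 0 2 0 + 2 * detCorr κ f g 0 0 0 1 + detCorr κ f g 0 0 1 1
      - 2 * detCorr κ f g 0 0 2 1 - detCorr κ f g 1 0 0 0 - 2 * detCorr κ f g 1 0 1 0
      + detCorr κ f g 1 0 2 0 - detCorr κ f g 1 0 0 1 + detCorr κ f g 1 0 1 1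
      - 2 * detCorr κ f g 1 0 2 1 ≤ 1 := by
  have two : ∀ x : Fin 2, x = 0 ∨ x = 1 := by decide
  -- Alice's output only matters on her first input: sum over it on the other two.
  have marg : ∀ i j, detCorr κ f g 0 0 i j + detCorr κ f g 1 0 i j
      = if g (j, κ i) = 0 then 1 else 0 := by
    intro i j
    unfold detCorr
    rcases two (f i) with h | h <;> rcases two (g (j, κ i)) with h' | h' <;> simp [h, h']
  have m10 := marg 1 0
  have m20 := marg 2 0
  have m11 := marg 1 1
  have m21 := marg 2 1
  have key : -3 * qA0 (detCorr κ f g) 0 + 2 * detCorr κ f g 0 0 0 0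
      + 2 * detCorr κ f g 0 0 0 1 - detCorr κ f g 1 0 0 0 - detCorr κ f g 1 0 0 1
      - 2 * (if g (0, κ 1) = 0 then 1 else 0) + (if g (0, κ 2) = 0 then 1 else 0)
      + (if g (1, κ 1) = 0 then 1 else 0) - 2 * (if g (1, κ 2) = 0 then 1 else 0) ≤ 1 := by
    clear m10 m20 m11 m21 marg
    unfold qA0 detCorr
    generalize f 0 = a
    generalize κ 0 = k0
    generalize κ 1 = k1
    generalize κ 2 = k2
    rcases two a with rfl | rfl <;> rcases two k0 with rfl | rfl <;>
      rcases two k1 with rfl | rfl <;> rcases two k2 with rfl | rfl <;>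
      rcases two (g (0, 0)) with h1 | h1 <;> rcases two (g (0, 1)) with h2 | h2 <;>
      rcases two (g (1, 0)) with h3 | h3 <;> rcases two (g (1, 1)) with h4 | h4 <;>
      simp only [h1, h2, h3, h4] <;> norm_num
  linarith

/-- Bell inequality VIII for LSR plus one bit of Alice→Bob communication. -/
theorem bell_VIII (p : Fin 2 → Fin 2 → Fin 3 → Fin 2 → ℝ) (h : AchievableAtoB p) :
    -3 * qA0 p 0 + 2 * p 0 0 0 0 - 2 * p 0 0 1 0 + p 0 0 2 0 + 2 * p 0 0 0 1 + p 0 0 1 1 - 2 * p 0 0 2 1 - p 1 0 0 0 - 2 * p 1 0 1 0 + p 1 0 2 0 - p 1 0 0 1 + p 1 0 1 1 - 2 * p 1 0 2 1 ≤ 1 := by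
  obtain ⟨n, w, κ, f, g, hw, hs, hp⟩ := h
  have hsum := Finset.sum_le_sum (s := Finset.univ) fun k _ =>
    mul_le_mul_of_nonneg_left (det_bound (κ k) (f k) (g k)) (hw k)
  simp only [mul_one, hs] at hsum
  refine le_trans (le_of_eq ?_) hsum
  simp only [qA0, hp, Finset.mul_sum, ← Finset.sum_add_distrib, ← Finset.sum_sub_distrib]
  refine Finset.sum_congr rfl fun k _ => ?_
  ring
end
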